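/- Commutant lifting: Let B be a unital C*-subalgebra of B(K) and V ∈ B(H,K) with K equal to the closed span of B V H. Then for every A in the commutant of V* B V in B(H), there exists a unique A₁ in the commutant B′ of B such that V A = A₁ V. -/

import Mathlib

noncomputable section

/-- Every element of a closed star subalgebra of a C⋆-algebra is a linear combination of
unitaries belonging to the subalgebra. -/
theorem StarSubalgebra.mem_span_unitary {A : Type*} [CStarAlgebra A] (M : StarSubalgebra ℂ A)
    (hM : IsClosed (M : Set A)) {a : A} (ha : a ∈ M) :
    a ∈ Submodule.span ℂ {u : A | u ∈ unitary A ∧ u ∈ M} := by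
  let _ : CStarAlgebra M := StarSubalgebra.cstarAlgebra M (h_closed := hM)
  have h : (⟨a, ha⟩ : M) ∈ Submodule.span ℂ (unitary M : Set M) := by
    rw [CStarAlgebra.span_unitary]
    trivial
  have h' := Submodule.mem_map_of_mem (f := M.subtype.toLinearMap) h
  rw [Submodule.map_span] at h'
  refine Submodule.span_mono ?_ h'
  rintro _ ⟨u, hu, rfl⟩
  exact ⟨Unitary.map_mem M.subtype hu, u.2⟩

section CommutantLifting

open ContinuousLinearMap

variable {H K : Type*} [NormedAddCommGroup H] [InnerProductSpace ℂ H]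
  [NormedAddCommGroup K] [InnerProductSpace ℂ K]

/-- The linear map sending a formal combination `∑ cᵢ (bᵢ, hᵢ)` to `∑ cᵢ bᵢ V A hᵢ`. -/
def twistedSum (S : Set (K →L[ℂ] K)) (V : H →L[ℂ] K) (A : H →L[ℂ] H) :
    (S × H →₀ ℂ) →ₗ[ℂ] K :=
  Finsupp.linearCombination ℂ fun p => (p.1 : K →L[ℂ] K) (V (A p.2))

theorem twistedSum_single (S : Set (K →L[ℂ] K)) (V : H →L[ℂ] K) (A : H →L[ℂ] H) (p : S × H) :
    twistedSum S V A (Finsupp.single p 1) = (p.1 : K →L[ℂ] K) (V (A p.2)) := by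
  simp [twistedSum]

theorem twistedSum_zero (S : Set (K →L[ℂ] K)) (V : H →L[ℂ] K) : twistedSum S V 0 = 0 := by
  ext p
  simp [twistedSum]

theorem twistedSum_add (S : Set (K →L[ℂ] K)) (V : H →L[ℂ] K) (A C : H →L[ℂ] H) :
    twistedSum S V (A + C) = twistedSum S V A + twistedSum S V C := by
  ext p
  simp [twistedSum]

theorem twistedSum_smul (S : Set (K →L[ℂ] K)) (V : H →L[ℂ] K) (c : ℂ) (A : H →L[ℂ] H) :
    twistedSum S V (c • A) = c • twistedSum S V A := by
  ext p
  simp [twistedSum]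

theorem range_twistedSum_one (S : Set (K →L[ℂ] K)) (V : H →L[ℂ] K) :
    LinearMap.range (twistedSum S V 1) =
      Submodule.span ℂ {k : K | ∃ b ∈ S, ∃ h : H, k = b (V h)} := by
  rw [twistedSum, Finsupp.range_linearCombination]
  congr 1
  ext k
  simp [eq_comm]

variable [CompleteSpace H] [CompleteSpace K]

/-- The compressions `V* b V` for `b` in a star subalgebra `B`. -/
def compressions (B : StarSubalgebra ℂ (K →L[ℂ] K)) (V : H →L[ℂ] K) : Set (H →L[ℂ] H) :=
  {T | ∃ b ∈ B, T = (adjoint V).comp (b.comp V)}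

theorem mem_centralizer_compressions_iff {B : StarSubalgebra ℂ (K →L[ℂ] K)} {V : H →L[ℂ] K}
    {A : H →L[ℂ] H} :
    A ∈ StarSubalgebra.centralizer ℂ (compressions B V) ↔
      ∀ b ∈ B, A * ((adjoint V).comp (b.comp V)) = ((adjoint V).comp (b.comp V)) * A := by
  rw [StarSubalgebra.mem_centralizer_iff]
  constructor
  · intro h b hb
    exact (h _ ⟨b, hb, rfl⟩).1.symm
  · rintro h _ ⟨b, hb, rfl⟩
    refine ⟨(h b hb).symm, ?_⟩
    have e : star ((adjoint V).comp (b.comp V)) = (adjoint V).comp ((star b).comp V) := by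
      simp [star_eq_adjoint, adjoint_comp, ContinuousLinearMap.comp_assoc]
    rw [e]
    exact (h _ (star_mem hb)).symm

theorem norm_twistedSum_unitary {B : StarSubalgebra ℂ (K →L[ℂ] K)} {V : H →L[ℂ] K}
    {U : H →L[ℂ] H} (hU : U ∈ unitary (H →L[ℂ] H))
    (hUB : U ∈ StarSubalgebra.centralizer ℂ (compressions B V)) (x : ↥(B : Set (K →L[ℂ] K)) × H →₀ ℂ) :
    ‖twistedSum (B : Set _) V U x‖ = ‖twistedSum (B : Set _) V 1 x‖ := by
  have key (p q : ↥(B : Set (K →L[ℂ] K)) × H) :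
      inner ℂ ((p.1 : K →L[ℂ] K) (V (U p.2))) ((q.1 : K →L[ℂ] K) (V (U q.2))) =
        inner ℂ ((p.1 : K →L[ℂ] K) (V p.2)) ((q.1 : K →L[ℂ] K) (V q.2)) := by
    have hb : star (p.1 : K →L[ℂ] K) * (q.1 : K →L[ℂ] K) ∈ B := mul_mem (star_mem p.1.2) q.1.2
    have hcomp (h k : H) : inner ℂ ((p.1 : K →L[ℂ] K) (V h)) ((q.1 : K →L[ℂ] K) (V k)) =
        inner ℂ h (((adjoint V).comp
          ((star (p.1 : K →L[ℂ] K) * (q.1 : K →L[ℂ] K)).comp V)) k) := by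
      simp [star_eq_adjoint, adjoint_inner_right]
    have hcomm := DFunLike.congr_fun (mem_centralizer_compressions_iff.1 hUB _ hb) q.2
    rw [mul_apply_eq_comp, mul_apply_eq_comp] at hcomm
    rw [hcomp, hcomp, ← hcomm, ← adjoint_inner_right, ← star_eq_adjoint, ← mul_apply_eq_comp,
      Unitary.star_mul_self_of_mem hU, one_apply_eq_self]
  have hinner : inner ℂ (twistedSum (B : Set _) V U x) (twistedSum (B : Set _) V U x) =
      inner ℂ (twistedSum (B : Set _) V 1 x) (twistedSum (B : Set _) V 1 x) := by
    simp only [twistedSum, Finsupp.linearCombination_apply, Finsupp.sum, sum_inner, inner_sum,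
      inner_smul_left, inner_smul_right, key, one_apply_eq_self]
  rw [@norm_eq_sqrt_re_inner ℂ, hinner, ← @norm_eq_sqrt_re_inner ℂ]

theorem exists_norm_twistedSum_le {B : StarSubalgebra ℂ (K →L[ℂ] K)} {V : H →L[ℂ] K}
    {A : H →L[ℂ] H} (hA : A ∈ StarSubalgebra.centralizer ℂ (compressions B V)) :
    ∃ C : ℝ, ∀ x, ‖twistedSum (B : Set _) V A x‖ ≤ C * ‖twistedSum (B : Set _) V 1 x‖ := by
  have hclosed : IsClosed
      (StarSubalgebra.centralizer ℂ (compressions B V) : Set (H →L[ℂ] H)) :=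
    Set.isClosed_centralizer _
  have hspan := StarSubalgebra.mem_span_unitary _ hclosed hA
  clear hA
  induction hspan using Submodule.span_induction with
  | mem U hU => exact ⟨1, fun x => by rw [one_mul, norm_twistedSum_unitary hU.1 hU.2]⟩
  | zero => exact ⟨0, fun x => by simp [twistedSum_zero]⟩
  | add A A' _ _ h h' =>
    obtain ⟨C, hC⟩ := h
    obtain ⟨C', hC'⟩ := h'
    refine ⟨C + C', fun x => ?_⟩
    rw [twistedSum_add, add_mul]
    exact norm_add_le_of_le (hC x) (hC' x)
  | smul c A _ h =>
    obtain ⟨C, hC⟩ := h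
    refine ⟨‖c‖ * C, fun x => ?_⟩
    rw [twistedSum_smul, LinearMap.smul_apply, norm_smul, mul_assoc]
    gcongr
    exact hC x

end CommutantLifting

/-- Commutant lifting theorem (Arveson): if `B` is a unital C*-subalgebra of `B(K)` and
`V ∈ B(H,K)` with `K` the closed span of `B V H`, then every `A` in the commutant of
`V* B V` lifts to a unique `A₁` in the commutant of `B` with `V A = A₁ V`. -/
theorem commutant_lifting
    {H K : Type*} [NormedAddCommGroup H] [InnerProductSpace ℂ H] [CompleteSpace H]
    [NormedAddCommGroup K] [InnerProductSpace ℂ K] [CompleteSpace K]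
    (B : StarSubalgebra ℂ (K →L[ℂ] K)) (V : H →L[ℂ] K)
    (hspan : (Submodule.span ℂ
        {k : K | ∃ b ∈ B, ∃ h : H, k = b (V h)}).topologicalClosure = ⊤) :
    ∀ A : H →L[ℂ] H,
      (∀ b ∈ B, A * ((ContinuousLinearMap.adjoint V).comp (b.comp V)) =
          ((ContinuousLinearMap.adjoint V).comp (b.comp V)) * A) →
      ∃! A₁ : K →L[ℂ] K, (∀ b ∈ B, A₁ * b = b * A₁) ∧ V.comp A = A₁.comp V := by
  intro A hA
  have hdense : Dense (Submodule.span ℂ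
      {k : K | ∃ b ∈ B, ∃ h : H, k = b (V h)} : Set K) :=
    Submodule.dense_iff_topologicalClosure_eq_top.2 hspan
  have hrange : DenseRange (twistedSum (B : Set _) V 1) := by
    rw [DenseRange, ← LinearMap.coe_range, range_twistedSum_one]
    exact hdense
  have hbound := exists_norm_twistedSum_le (mem_centralizer_compressions_iff.2 hA)
  obtain ⟨A₁, hA₁⟩ : ∃ A₁ : K →L[ℂ] K, ∀ b ∈ B, ∀ h, A₁ (b (V h)) = b (V (A h)) := by
    refine ⟨(twistedSum (B : Set _) V A).extendOfNorm (twistedSum (B : Set _) V 1),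
      fun b hb h => ?_⟩
    have := LinearMap.extendOfNorm_eq hrange hbound (Finsupp.single (⟨b, hb⟩, h) 1)
    simpa only [twistedSum_single, one_apply_eq_self] using this
  refine ⟨A₁, ⟨fun b hb => ?_, ?_⟩, ?_⟩
  · refine ContinuousLinearMap.ext_on hdense ?_
    rintro _ ⟨c, hc, h, rfl⟩
    have := hA₁ (b * c) (mul_mem hb hc) h
    simp only [mul_apply_eq_comp] at this ⊢
    rw [this, hA₁ c hc h]
  · ext h
    simpa using (hA₁ 1 (one_mem B) h).symm
  · rintro A₂ ⟨hcomm, hV⟩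
    refine ContinuousLinearMap.ext_on hdense ?_
    rintro _ ⟨b, hb, h, rfl⟩
    rw [hA₁ b hb h, ← mul_apply_eq_comp, hcomm b hb, mul_apply_eq_comp,
      ← ContinuousLinearMap.comp_apply A₂, ← hV, ContinuousLinearMap.comp_apply]
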